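/- Let d ≥ 2 and let T_d be the degree-d polynomial with complex coefficients determined by T_d(t + t⁻¹) = t^d + t^{-d} for all nonzero t ∈ ℂ (the normalized Chebyshev polynomial, satisfying T_d(2cos θ) = 2cos dθ). Fix the basepoint 0 ∈ ℂ ∖ {−2, 2}, and let N ⊆ π₁(ℂ ∖ {−2, 2}, 0) be the set of homotopy classes of loops γ such that for every k ≥ 1 every lift of γ by T_d^k (every path γ̃ with T_d^k ∘ γ̃ = γ) is a loop. Then N is a normal subgroup, and the quotient π₁(ℂ ∖ {−2, 2}, 0)/N — the iterated monodromy group of T_d — is isomorphic to the infinite dihedral group ⟨a, b ∣ a² = b² = 1⟩. -/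

import Mathlib

open scoped ContinuousMap
noncomputable section

attribute [local instance] Path.Homotopic.setoid

lemma zero_mem_compl_pm_two : (0 : ℂ) ∈ ({-2, 2} : Set ℂ)ᶜ := by norm_num

/-- The complement of the critical points of `z ↦ 2 cos z`. -/
abbrev CosRegular : Type := {z : ℂ // Complex.sin z ≠ 0}

namespace CosRegular

open Complex Topology
open scoped Real

lemma cos_add_two_pi_mul_int (n : ℤ) (z : ℂ) : cos (z + 2 * π * n) = cos z := by
  rw [show z + 2 * π * n = z + n * (2 * π) by ring, cos_add_int_mul_two_pi]

/-- The action of the infinite dihedral group on `ℂ` by `z ↦ ±(z + 2πn)`. -/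
def dihedralAct : DihedralGroup 0 → ℂ → ℂ
  | .r i, z => z + 2 * π * Int.cast (R := ℂ) i
  | .sr i, z => -(z + 2 * π * Int.cast (R := ℂ) i)

lemma dihedralAct_r (i : ℤ) (z : ℂ) : dihedralAct (.r i) z = z + 2 * π * i := rfl

lemma dihedralAct_sr (i : ℤ) (z : ℂ) : dihedralAct (.sr i) z = -(z + 2 * π * i) := rfl

lemma dihedralAct_mul (g h : DihedralGroup 0) (z : ℂ) :
    dihedralAct (g * h) z = dihedralAct g (dihedralAct h z) := by
  have hadd (i j : ZMod 0) :
      Int.cast (R := ℂ) (i + j) = Int.cast (R := ℂ) i + Int.cast (R := ℂ) j := Int.cast_add i j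
  have hsub (i j : ZMod 0) :
      Int.cast (R := ℂ) (i - j) = Int.cast (R := ℂ) i - Int.cast (R := ℂ) j := Int.cast_sub i j
  rcases g with i | i <;> rcases h with j | j <;>
    simp only [DihedralGroup.r_mul_r, DihedralGroup.r_mul_sr, DihedralGroup.sr_mul_r,
      DihedralGroup.sr_mul_sr, dihedralAct, hadd, hsub] <;> ring

lemma dihedralAct_one (z : ℂ) : dihedralAct 1 z = z := by
  have h : Int.cast (R := ℂ) (0 : ZMod 0) = 0 := Int.cast_zero
  rw [DihedralGroup.one_def, dihedralAct, h, mul_zero, add_zero]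

lemma cos_dihedralAct (g : DihedralGroup 0) (z : ℂ) : cos (dihedralAct g z) = cos z := by
  rcases g with i | i
  · exact cos_add_two_pi_mul_int i z
  · exact (cos_neg _).trans (cos_add_two_pi_mul_int i z)

lemma sin_ne_zero_iff_cos_sq_ne_one {z : ℂ} : sin z ≠ 0 ↔ cos z ^ 2 ≠ 1 := by
  rw [← sin_sq_add_cos_sq z, ne_eq, ne_eq, right_eq_add, sq_eq_zero_iff]

lemma sin_dihedralAct_ne_zero (g : DihedralGroup 0) {z : ℂ} (hz : sin z ≠ 0) :
    sin (dihedralAct g z) ≠ 0 := by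
  rw [sin_ne_zero_iff_cos_sq_ne_one] at hz ⊢
  rwa [cos_dihedralAct]

instance : MulAction (DihedralGroup 0) CosRegular where
  smul g z := ⟨dihedralAct g z, sin_dihedralAct_ne_zero g z.2⟩
  one_smul z := Subtype.ext (dihedralAct_one z)
  mul_smul g h z := Subtype.ext (dihedralAct_mul g h z)

lemma coe_smul (g : DihedralGroup 0) (z : CosRegular) :
    ((g • z : CosRegular) : ℂ) = dihedralAct g z := rfl

instance : ContinuousConstSMul (DihedralGroup 0) CosRegular where
  continuous_const_smul g := by
    refine Continuous.subtype_mk ?_ _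
    rcases g with i | i <;> simp only [dihedralAct] <;> fun_prop

lemma eq_one_of_smul_eq {g : DihedralGroup 0} {z : CosRegular} (h : g • z = z) : g = 1 := by
  have h' : dihedralAct g z = z := congrArg Subtype.val h
  rcases g with i | i
  · rw [dihedralAct, add_eq_left, mul_eq_zero] at h'
    have hi : i = (0 : ℤ) := Int.cast_eq_zero.mp (h'.resolve_left (by simp [Real.pi_ne_zero]))
    rw [hi]
    rfl
  · refine absurd (sin_eq_zero_iff.mpr ⟨-(show ℤ from i), ?_⟩) z.2
    rw [dihedralAct] at h'
    rw [Int.cast_neg]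
    linear_combination -h' / 2

lemma two_mul_cos_mem_compl {z : ℂ} : 2 * cos z ∈ ({-2, 2} : Set ℂ)ᶜ ↔ sin z ≠ 0 := by
  have h : 2 * cos z = -2 ∨ 2 * cos z = 2 ↔ cos z ^ 2 = 1 := by
    have h2 : (2 : ℂ) ≠ 0 := two_ne_zero
    rw [sq_eq_one_iff, or_comm, show (-2 : ℂ) = 2 * -1 by ring, mul_right_inj' h2,
      mul_eq_left₀ h2]
  rw [Set.mem_compl_iff, Set.mem_insert_iff, Set.mem_singleton_iff, h,
    sin_ne_zero_iff_cos_sq_ne_one]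

/-- The covering map `z ↦ 2 cos z` onto `ℂ ∖ {-2, 2}`. -/
def twoCos (z : CosRegular) : (({-2, 2} : Set ℂ)ᶜ : Set ℂ) :=
  ⟨2 * cos z, two_mul_cos_mem_compl.mpr z.2⟩

lemma continuous_twoCos : Continuous twoCos :=
  Continuous.subtype_mk (by fun_prop) _

lemma hasStrictDerivAt_two_mul_cos (z : ℂ) :
    HasStrictDerivAt (fun w ↦ 2 * cos w) (2 * -sin z) z :=
  (hasStrictDerivAt_cos z).const_mul 2

lemma surjective_twoCos : Function.Surjective twoCos := by
  rintro ⟨x, hx⟩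
  obtain ⟨z, hz⟩ := cos_surjective (x / 2)
  have hzx : 2 * cos z = x := by rw [hz]; ring
  exact ⟨⟨z, two_mul_cos_mem_compl.mp (hzx ▸ hx)⟩, Subtype.ext hzx⟩

lemma isOpenMap_twoCos : IsOpenMap twoCos := by
  refine IsOpenMap.of_nhds_le fun z ↦ ?_
  have hE : IsOpen {z : ℂ | sin z ≠ 0} := isOpen_ne_fun continuous_sin continuous_const
  have hX : IsOpen (({-2, 2} : Set ℂ)ᶜ) := (Set.toFinite _).isClosed.isOpen_compl
  refine (Filter.map_le_map_iff Subtype.val_injective).mp ?_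
  rw [hX.isOpenEmbedding_subtypeVal.map_nhds_eq, Filter.map_map]
  change 𝓝 (2 * cos (z : ℂ)) ≤ Filter.map ((fun w ↦ 2 * cos w) ∘ Subtype.val) (𝓝 z)
  rw [← Filter.map_map, show Filter.map Subtype.val (𝓝 z) = 𝓝 (z : ℂ) from
      hE.isOpenEmbedding_subtypeVal.map_nhds_eq z,
    (hasStrictDerivAt_two_mul_cos z).map_nhds_eq (by simpa using z.2)]

lemma twoCos_eq_iff {z w : CosRegular} :
    twoCos z = twoCos w ↔ z ∈ MulAction.orbit (DihedralGroup 0) w := by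
  constructor
  · intro h
    have h' : 2 * cos (z : ℂ) = 2 * cos (w : ℂ) := congrArg Subtype.val h
    obtain ⟨k, hk | hk⟩ := cos_eq_cos_iff.mp (mul_left_cancel₀ two_ne_zero h').symm
    · refine ⟨.r k, Subtype.ext ?_⟩
      simp only [coe_smul, dihedralAct]
      rw [hk]; ring
    · refine ⟨.sr (-k : ℤ), Subtype.ext ?_⟩
      simp only [coe_smul, dihedralAct]
      rw [hk, Int.cast_neg]; ring
  · rintro ⟨g, rfl⟩
    exact Subtype.ext (congrArg (2 * ·) (cos_dihedralAct g w))

theorem isQuotientCoveringMap_twoCos : IsQuotientCoveringMap twoCos (DihedralGroup 0) where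
  __ := isOpenMap_twoCos.isQuotientMap continuous_twoCos surjective_twoCos
  continuous_const_smul := continuous_const_smul
  apply_eq_iff_mem_orbit := twoCos_eq_iff
  disjoint z := by
    have hz : 2 * -sin (z : ℂ) ≠ 0 := by simpa using z.2
    have hd := hasStrictDerivAt_two_mul_cos z
    refine ⟨Subtype.val ⁻¹' {w | hd.localInverse _ _ _ hz (2 * cos w) = w},
      continuous_subtype_val.continuousAt.preimage_mem_nhds
        (hd.hasStrictFDerivAt_equiv hz).eventually_left_inverse, ?_⟩
    rintro g ⟨_, ⟨w, hw, rfl⟩, hgw⟩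
    refine eq_one_of_smul_eq (z := w) (Subtype.ext ?_)
    simp only [Set.mem_preimage, Set.mem_ofPred_eq, coe_smul, cos_dihedralAct] at hw hgw
    exact hgw.symm.trans hw

instance : PathConnectedSpace CosRegular := by
  have hc : {z : ℂ | sin z = 0}.Countable := by
    refine (Set.countable_range fun k : ℤ ↦ (k * π : ℂ)).mono fun z hz ↦ ?_
    obtain ⟨k, hk⟩ := sin_eq_zero_iff.mp hz
    exact ⟨k, hk.symm⟩
  exact isPathConnected_iff_pathConnectedSpace.mp
    (hc.isPathConnected_compl_of_one_lt_rank (by simp [rank_real_complex]))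

end CosRegular

namespace ChebyshevIMG

open Complex CosRegular
open scoped Real

lemma eval_two_mul_cos {d : ℕ} {T : Polynomial ℂ}
    (hT : ∀ t : ℂ, t ≠ 0 → T.eval (t + t⁻¹) = t ^ d + (t⁻¹) ^ d) (z : ℂ) :
    T.eval (2 * cos z) = 2 * cos (d * z) := by
  have h := hT (exp (z * I)) (exp_ne_zero _)
  rw [← exp_neg, ← exp_nat_mul, ← exp_nat_mul] at h
  rw [two_cos, two_cos]
  convert h using 3 <;> ring_nf

lemma iterate_eval_two_mul_cos {d : ℕ} {T : Polynomial ℂ}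
    (hT : ∀ t : ℂ, t ≠ 0 → T.eval (t + t⁻¹) = t ^ d + (t⁻¹) ^ d) (k : ℕ) (z : ℂ) :
    (fun w ↦ T.eval w)^[k] (2 * cos z) = 2 * cos ((d ^ k : ℕ) * z) := by
  induction k with
  | zero => simp
  | succ k ih =>
    rw [Function.iterate_succ_apply', ih, eval_two_mul_cos hT, pow_succ']
    push_cast
    rw [mul_assoc]

/-- The point `0` of `ℂ ∖ {-2, 2}`. -/
abbrev base : (({-2, 2} : Set ℂ)ᶜ : Set ℂ) := ⟨0, zero_mem_compl_pm_two⟩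

/-- The point `π / 2`, lying over the base point `0`. -/
def halfPi : twoCos ⁻¹' {base} :=
  ⟨⟨π / 2, by simp⟩, Subtype.ext (by simp [twoCos])⟩

/-- A lift of a loop by an iterate of the Chebyshev polynomial is covered, up to scaling, by a
lift of the loop by `z ↦ 2 cos z`. -/
lemma lift_closed {d : ℕ} (hd : d ≠ 0) {T : Polynomial ℂ}
    (hT : ∀ t : ℂ, t ≠ 0 → T.eval (t + t⁻¹) = t ^ d + (t⁻¹) ^ d)
    (γ : Path base base)
    (hγ : ∀ e : twoCos ⁻¹' {base}, ∀ θ : C(unitInterval, CosRegular),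
      twoCos ∘ θ = γ → θ 0 = e → θ 1 = e)
    (k : ℕ) (γ' : C(unitInterval, ℂ))
    (hlift : ∀ t, (fun z ↦ T.eval z)^[k] (γ' t) = (γ t : ℂ)) : γ' 0 = γ' 1 := by
  set n := d ^ k with hn
  have hn0 : (n : ℂ) ≠ 0 := by exact_mod_cast pow_ne_zero k hd
  have hscale (z : ℂ) (t : unitInterval) (hz : 2 * cos z = γ' t) : 2 * cos (n * z) = γ t := by
    rw [← hlift, ← hz, iterate_eval_two_mul_cos hT]
  have hreg (z : ℂ) (t : unitInterval) (hz : 2 * cos z = γ' t) : sin (n * z) ≠ 0 :=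
    two_mul_cos_mem_compl.mp (hscale z t hz ▸ (γ t).2)
  have hmem (t : unitInterval) : γ' t ∈ ({-2, 2} : Set ℂ)ᶜ := by
    obtain ⟨z, hz⟩ := cos_surjective (γ' t / 2)
    have hz' : 2 * cos z = γ' t := by rw [hz]; ring
    rw [← hz', two_mul_cos_mem_compl]
    intro h0
    obtain ⟨m, hm⟩ := sin_eq_zero_iff.mp h0
    refine hreg z t hz' (sin_eq_zero_iff.mpr ⟨n * m, ?_⟩)
    rw [hm]; push_cast; ring
  let δ : C(unitInterval, (({-2, 2} : Set ℂ)ᶜ : Set ℂ)) :=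
    ⟨fun t ↦ ⟨γ' t, hmem t⟩, by fun_prop⟩
  obtain ⟨e, he⟩ := surjective_twoCos (δ 0)
  obtain ⟨ψ, hψ, -⟩ := isQuotientCoveringMap_twoCos.isCoveringMap.exists_path_lifts δ e he.symm
  have hψ' (t : unitInterval) : 2 * cos (ψ t : ℂ) = γ' t := congrArg Subtype.val (congrFun hψ t)
  let θ : C(unitInterval, CosRegular) := ⟨fun t ↦ ⟨n * ψ t, hreg _ t (hψ' t)⟩, by fun_prop⟩
  have hθ : twoCos ∘ θ = γ := funext fun t ↦ Subtype.ext (hscale _ t (hψ' t))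
  have hθ0 : twoCos (θ 0) = base := (congrFun hθ 0).trans γ.source
  have hclosed : (n : ℂ) * ψ 1 = n * ψ 0 := congrArg Subtype.val (hγ ⟨θ 0, hθ0⟩ θ hθ rfl)
  rw [← hψ' 0, ← hψ' 1, mul_left_cancel₀ hn0 hclosed]

/-- An element of the dihedral group for which the cosines of all translates of `π / 2`,
scaled by `1 / n` with `n` large, agree is trivial. -/
lemma dihedral_eq_one {d : ℕ} (hd : 2 ≤ d) (g : DihedralGroup 0)
    (h : ∀ k : ℕ, 1 ≤ k → ∀ j : ℤ,
      cos ((dihedralAct g (π / 2) + 2 * π * j) / (d ^ k : ℕ)) =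
        cos ((π / 2 + 2 * π * j) / (d ^ k : ℕ))) : g = 1 := by
  have hπ : (π : ℂ) ≠ 0 := by simp [Real.pi_ne_zero]
  obtain ⟨m, hm⟩ : ∃ m : ℤ, g = .r m ∨ g = .sr m := by
    rcases g with i | i
    exacts [⟨i, .inl rfl⟩, ⟨i, .inr rfl⟩]
  set k := m.natAbs + 2
  set n := d ^ k with hn
  have hnk : k < n := Nat.lt_pow_self hd
  have hn4 : 4 ≤ n := by
    calc 4 = 2 ^ 2 := rfl
      _ ≤ d ^ 2 := Nat.pow_le_pow_left hd 2
      _ ≤ d ^ k := Nat.pow_le_pow_right (by omega) (by omega)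
  have hnC : (n : ℂ) ≠ 0 := by exact_mod_cast (by omega : n ≠ 0)
  have key (j : ℤ) : ∃ l : ℤ, dihedralAct g (π / 2) = 2 * π * (l * n) + π / 2 ∨
      dihedralAct g (π / 2) = 2 * π * (l * n) - π / 2 - 4 * π * j := by
    obtain ⟨l, hl | hl⟩ := cos_eq_cos_iff.mp (h k (by omega) j).symm
    all_goals
      rw [← hn] at hl
      field_simp at hl
    · exact ⟨l, .inl (by linear_combination hl / 2)⟩
    · exact ⟨l, .inr (by linear_combination hl / 2)⟩
  have hzero {l : ℤ} (hl : m = l * n) : m = 0 := by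
    refine Int.eq_zero_of_abs_lt_dvd (m := n) ⟨l, by rw [hl, mul_comm]⟩ ?_
    rw [Int.abs_eq_natAbs]
    omega
  rcases hm with rfl | rfl
  · obtain ⟨l, hl | hl⟩ := key 0
    · have : m = l * n := by
        have : (m : ℂ) = l * n := by
          apply mul_left_cancel₀ hπ
          rw [dihedralAct_r] at hl
          linear_combination hl / 2
        exact_mod_cast this
      rw [hzero this]
      rfl
    · exfalso
      have : 1 + 2 * m = 2 * (l * n) := by
        have : (1 + 2 * m : ℂ) = 2 * (l * n) := by
          apply mul_left_cancel₀ hπ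
          rw [dihedralAct_r] at hl
          push_cast at hl
          linear_combination hl
        exact_mod_cast this
      omega
  · exfalso
    obtain ⟨l, hl | hl⟩ := key 0
    · have : -1 - 2 * m = 2 * (l * n) := by
        have : (-1 - 2 * m : ℂ) = 2 * (l * n) := by
          apply mul_left_cancel₀ hπ
          rw [dihedralAct_sr] at hl
          linear_combination hl
        exact_mod_cast this
      omega
    · have hm0 : m = 0 := by
        refine hzero (l := -l) ?_
        have : (m : ℂ) = -l * n := by
          apply mul_left_cancel₀ hπ
          rw [dihedralAct_sr] at hl
          push_cast at hl
          linear_combination -hl / 2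
        exact_mod_cast this
      obtain ⟨l', hl' | hl'⟩ := key 1
      · have : -1 - 2 * m = 2 * (l' * n) := by
          have : (-1 - 2 * m : ℂ) = 2 * (l' * n) := by
            apply mul_left_cancel₀ hπ
            rw [dihedralAct_sr] at hl'
            linear_combination hl'
          exact_mod_cast this
        omega
      · have h2 : 2 - m = l' * n := by
          have : (2 - m : ℂ) = l' * n := by
            apply mul_left_cancel₀ hπ
            rw [dihedralAct_sr] at hl'
            push_cast at hl'
            linear_combination hl' / 2
          exact_mod_cast this
        have := Int.le_of_dvd (by omega : (0 : ℤ) < 2 - m) ⟨l', by rw [h2, mul_comm]⟩ (a := n)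
        omega

lemma dihedral_eq_one_of_lifts_closed {d : ℕ} (hd : 2 ≤ d) {T : Polynomial ℂ}
    (hT : ∀ t : ℂ, t ≠ 0 → T.eval (t + t⁻¹) = t ^ d + (t⁻¹) ^ d)
    (γ : Path base base)
    (hγ : ∀ k : ℕ, 1 ≤ k → ∀ γ' : C(unitInterval, ℂ),
      (∀ t, (fun z ↦ T.eval z)^[k] (γ' t) = (γ t : ℂ)) → γ' 0 = γ' 1)
    (θ : C(unitInterval, CosRegular)) (hθ : twoCos ∘ θ = γ) (hθ0 : θ 0 = halfPi)
    (g : DihedralGroup 0) (hg : θ 1 = g • (halfPi : CosRegular)) : g = 1 := by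
  refine dihedral_eq_one hd g fun k hk j ↦ ?_
  have hn : ((d ^ k : ℕ) : ℂ) ≠ 0 := by exact_mod_cast pow_ne_zero k (by omega)
  have h := hγ k hk ⟨fun t ↦ 2 * cos (((θ t : ℂ) + 2 * π * j) / (d ^ k : ℕ)), by fun_prop⟩ ?_
  · simp only [ContinuousMap.coe_mk, hθ0, hg, coe_smul] at h
    exact (mul_left_cancel₀ two_ne_zero h).symm
  · intro t
    rw [ContinuousMap.coe_mk, iterate_eval_two_mul_cos hT, mul_div_cancel₀ _ hn,
      cos_add_two_pi_mul_int]
    exact congrArg Subtype.val (congrFun hθ t)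

end ChebyshevIMG

/-- Let `T` be the degree-`d` Chebyshev polynomial, normalized by
`T(t + t⁻¹) = t^d + t^(-d)`. The set `N` of homotopy classes of loops in `ℂ ∖ {-2, 2}`
based at `0` all of whose lifts by all iterates `T^k` are loops is a normal subgroup of
`π₁(ℂ ∖ {-2, 2}, 0)`, and the quotient by `N` — the iterated monodromy group of `T` — is
isomorphic to the infinite dihedral group (expressed here by a surjective homomorphism
onto `DihedralGroup 0` with kernel `N`). -/
theorem img_chebyshev_iso_infiniteDihedral
    (d : ℕ) (hd : 2 ≤ d) (T : Polynomial ℂ) (hdeg : T.natDegree = d)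
    (hT : ∀ t : ℂ, t ≠ 0 → T.eval (t + t⁻¹) = t ^ d + (t⁻¹) ^ d) :
    ∃ N : Subgroup (FundamentalGroup (({-2, 2} : Set ℂ)ᶜ : Set ℂ)
        ⟨0, zero_mem_compl_pm_two⟩),
      (N : Set (FundamentalGroup (({-2, 2} : Set ℂ)ᶜ : Set ℂ) ⟨0, zero_mem_compl_pm_two⟩)) =
        {g | ∀ γ : Path (⟨0, zero_mem_compl_pm_two⟩ : (({-2, 2} : Set ℂ)ᶜ : Set ℂ))
              ⟨0, zero_mem_compl_pm_two⟩,
          FundamentalGroup.toPath (X := TopCat.of (({-2, 2} : Set ℂ)ᶜ : Set ℂ)) g = ⟦γ⟧ →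
            ∀ k : ℕ, 1 ≤ k → ∀ γ' : C(unitInterval, ℂ),
              (∀ t, (fun z => T.eval z)^[k] (γ' t) = (γ t : ℂ)) → γ' 0 = γ' 1} ∧
      N.Normal ∧
      ∃ q : FundamentalGroup (({-2, 2} : Set ℂ)ᶜ : Set ℂ) ⟨0, zero_mem_compl_pm_two⟩ →*
          DihedralGroup 0,
        Function.Surjective q ∧ q.ker = N := by
  let hp := CosRegular.isQuotientCoveringMap_twoCos
  let Φ := hp.fundamentalGroupToMulOpposite ChebyshevIMG.halfPi
  refine ⟨Φ.ker, ?_, inferInstance,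
    (MulEquiv.inv' (DihedralGroup 0)).symm.toMonoidHom.comp Φ, ?_, ?_⟩
  · ext g
    rw [SetLike.mem_coe, Set.mem_ofPred_eq]
    constructor
    · intro hg γ hγ k _ γ' hlift
      refine ChebyshevIMG.lift_closed (by omega) hT γ (fun e θ hθ hθ0 ↦ ?_) k γ' hlift
      have hker : hp.isCoveringMap.monodromyPerm _ g = 1 := by
        rwa [hp.ker_fundamentalGroupToMulOpposite] at hg
      have he : hp.isCoveringMap.monodromy ⟦γ⟧ e = e := hγ ▸ DFunLike.congr_fun hker e
      rw [(hp.isCoveringMap.eq_liftPath_iff' (γ.source.trans e.2.symm)).mpr ⟨hθ, hθ0⟩]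
      exact congrArg Subtype.val he
    · intro h
      obtain ⟨γ, hγ⟩ := Quotient.exists_rep (FundamentalGroup.toPath g)
      let e := ChebyshevIMG.halfPi
      have hγ0 := γ.source.trans e.2.symm
      have hmon : (hp.isCoveringMap.monodromy g e : CosRegular) =
          hp.isCoveringMap.liftPath γ e hγ0 1 := by
        change (hp.isCoveringMap.monodromy (FundamentalGroup.toPath g) e : CosRegular) = _
        exact hγ ▸ rfl
      have hone := ChebyshevIMG.dihedral_eq_one_of_lifts_closed hd hT γ (h γ hγ.symm)
        (hp.isCoveringMap.liftPath γ e hγ0) (hp.isCoveringMap.liftPath_lifts ..)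
        (hp.isCoveringMap.liftPath_zero ..) (Φ g).unop
        (hmon.symm.trans hp.unop_fundamentalGroupToMulOpposite_smul.symm)
      exact MulOpposite.unop_injective hone
  · exact (MulEquiv.surjective (MulEquiv.inv' (DihedralGroup 0)).symm).comp
      (hp.fundamentalGroupToMulOpposite_surjective _)
  · exact MonoidHom.ker_mulEquiv_comp Φ (MulEquiv.inv' (DihedralGroup 0)).symm
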